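/- For every ε > 0 there exists N ∈ ℕ such that: (i) every finite set A ⊂ ℝ with |A| ≥ N satisfies |A + √2·A| ≥ ((1+√2)² − ε)·|A|, and (ii) there exists a finite set A ⊂ ℝ with |A| ≥ N and |A + √2·A| ≤ ((1+√2)² + ε)·|A|. In particular, the limit as n → ∞ of min{|A + √2·A|/|A| : A ⊂ ℝ, |A| = n} equals (1+√2)². -/

import Mathlib

open Finset
open scoped Pointwise

theorem conj_part {ι : Type*} (S : Finset ι) (f : ι → ℕ) :
    ∃ z : ℕ → ℕ, (∀ k v, 1 ≤ v → (v ≤ z k ↔ k < (S.filter (fun s => v ≤ f s)).card)) ∧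
      (∀ n, S.card ≤ n → ∑ k ∈ range n, z k = ∑ s ∈ S, f s) := by
  classical
  set M := ∑ s ∈ S, f s with hM
  have hle : ∀ s ∈ S, f s ≤ M := fun s hs => Finset.single_le_sum (f := f) (fun _ _ => Nat.zero_le _) hs
  let c : ℕ → ℕ := fun v => (S.filter (fun s => v ≤ f s)).card
  have hc : ∀ v w, v ≤ w → c w ≤ c v := by
    intro v w h
    apply Finset.card_le_card
    intro s hs
    simp only [mem_filter] at hs ⊢
    exact ⟨hs.1, h.trans hs.2⟩
  refine ⟨fun k => ((Icc 1 M).filter (fun v => k < c v)).card, ?_, ?_⟩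
  · intro k v hv
    change v ≤ ((Icc 1 M).filter (fun v => k < c v)).card ↔ k < c v
    constructor
    · intro h
      by_contra hk
      have : (Icc 1 M).filter (fun v => k < c v) ⊆ Icc 1 (v-1) := by
        intro w hw
        simp only [mem_filter, mem_Icc] at hw ⊢
        refine ⟨hw.1.1, ?_⟩
        by_contra h2
        have := hc v w (by omega)
        omega
      have := Finset.card_le_card this
      simp at this
      omega
    · intro h
      have : Icc 1 v ⊆ (Icc 1 M).filter (fun v => k < c v) := by
        intro w hw
        simp only [mem_filter, mem_Icc] at hw ⊢
        have hpos : 0 < c v := by omega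
        obtain ⟨s, hs⟩ := Finset.card_pos.1 hpos
        simp only [mem_filter] at hs
        have := hle s hs.1
        refine ⟨⟨hw.1, by omega⟩, lt_of_lt_of_le h (hc w v hw.2)⟩
      have := Finset.card_le_card this
      simpa using this
  · intro n hn
    simp only [Finset.card_filter]
    rw [Finset.sum_comm]
    have h1 : ∀ v, ∑ k ∈ range n, (if k < c v then 1 else 0) = c v := by
      intro v
      rw [← Finset.card_filter]
      have : (range n).filter (fun k => k < c v) = range (c v) := by
        ext k
        have : c v ≤ n := (Finset.card_filter_le _ _).trans hn
        simp only [mem_filter, mem_range]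
        omega
      rw [this, card_range]
    simp only [h1]
    simp only [c, Finset.card_filter]
    rw [Finset.sum_comm, hM]
    apply Finset.sum_congr rfl
    intro s hs
    rw [← Finset.card_filter]
    have : (Icc 1 M).filter (fun v => v ≤ f s) = Icc 1 (f s) := by
      ext v
      have := hle s hs
      simp only [mem_filter, mem_Icc]
      omega
    rw [this]; simp

theorem sum_div (c m : ℕ) (hc : 0 < c) (F : ℕ → ℕ) :
    ∑ t ∈ range (c * m), F (t / c) = c * ∑ i ∈ range m, F i := by
  induction m with
  | zero => simp
  | succ m ih =>
    rw [Nat.mul_succ, Finset.sum_range_add, ih, Finset.sum_range_succ, mul_add]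
    congr 1
    rw [Finset.sum_congr rfl (g := fun _ => F m)]
    · simp
    · intro r hr
      rw [Nat.mul_add_div hc, Nat.div_eq_of_lt (mem_range.1 hr), add_zero]

theorem path_sum (m n S : ℕ) (hm : 0 < m) (hn : 0 < n) (x y z : ℕ → ℕ)
    (hz : ∀ k l, k ≤ l → z l ≤ z k)
    (h : ∀ i j, i < m → j < n → x i + y j ≤ z (i + j) + 1)
    (hS : ∑ k ∈ range (m + n), z k ≤ S) :
    (m + n) * (n * ∑ i ∈ range m, x i + m * ∑ j ∈ range n, y j) ≤ m * n * (z 0 + S + (m + n)) := by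
  have e1 : ∑ t ∈ range (m * n * (m + n)), x (t / (n * (m + n))) = n * (m+n) * ∑ i ∈ range m, x i := by
    rw [← sum_div _ _ (by positivity)]; congr 2; ring
  have e2 : ∑ t ∈ range (m * n * (m + n)), y (t / (m * (m + n))) = m * (m+n) * ∑ i ∈ range n, y i := by
    rw [← sum_div _ _ (by positivity)]; congr 2; ring
  have e3 : ∑ t ∈ range (m * n * (m + n)), z (t / (m * n) - 1) = m * n * ∑ k ∈ range (m+n), z (k-1) := by
    exact sum_div (m * n) (m+n) (by positivity) (fun k => z (k-1))
  have e4 : ∑ k ∈ range (m+n), z (k-1) ≤ z 0 + S := by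
    obtain ⟨p, hp⟩ : ∃ p, m + n = p + 1 := ⟨m+n-1, by omega⟩
    rw [hp] at hS ⊢
    rw [Finset.sum_range_succ']
    rw [Finset.sum_range_succ] at hS
    simp only [Nat.add_sub_cancel, Nat.zero_sub]
    omega
  have key : ∑ t ∈ range (m * n * (m + n)), (x (t / (n * (m + n))) + y (t / (m * (m + n)))) ≤
      ∑ t ∈ range (m * n * (m + n)), (z (t / (m * n) - 1) + 1) := by
    apply Finset.sum_le_sum
    intro t ht
    rw [mem_range] at ht
    have hi : t / (n * (m+n)) < m := by
      rw [Nat.div_lt_iff_lt_mul (by positivity)]; calc t < _ := ht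
        _ = _ := by ring
    have hj : t / (m * (m+n)) < n := by
      rw [Nat.div_lt_iff_lt_mul (by positivity)]; calc t < _ := ht
        _ = _ := by ring
    refine (h _ _ hi hj).trans ?_
    gcongr
    apply hz
    set i := t / (n * (m+n)) with hi'
    set j := t / (m * (m+n)) with hj'
    have h1 : t < n * (m+n) * (i + 1) := Nat.lt_mul_div_succ t (by positivity)
    have h2 : t < m * (m+n) * (j + 1) := Nat.lt_mul_div_succ t (by positivity)
    have : t / (m * n) < i + j + 2 := by
      rw [Nat.div_lt_iff_lt_mul (by positivity)]
      have h3 : m * t + n * t < m * (n * (m+n) * (i + 1)) + n * (m * (m+n) * (j + 1)) := by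
        apply Nat.add_lt_add
        · exact Nat.mul_lt_mul_of_pos_left h1 hm
        · exact Nat.mul_lt_mul_of_pos_left h2 hn
      have h4 : (m + n) * t < (m+n) * ((i + j + 2) * (m * n)) := by
        calc (m+n)*t = m * t + n * t := by ring
          _ < _ := h3
          _ = _ := by ring
      exact Nat.lt_of_mul_lt_mul_left h4
    exact Nat.sub_le_iff_le_add.2 (Nat.lt_succ_iff.1 this)
  rw [Finset.sum_add_distrib, Finset.sum_add_distrib, e1, e2, e3] at key
  simp only [sum_const, card_range, smul_eq_mul, mul_one] at key
  have := Nat.mul_le_mul_left (m * n) e4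
  calc _ = n * (m + n) * ∑ i ∈ range m, x i + m * (m + n) * ∑ i ∈ range n, y i := by ring
    _ ≤ m * n * ∑ k ∈ range (m + n), z (k - 1) + m * n * (m + n) := key
    _ ≤ m * n * (z 0 + S) + m * n * (m+n) := by omega
    _ = _ := by ring

theorem fibre_mul {G Q : Type*} [AddCommGroup G] [AddCommGroup Q] [DecidableEq G] [DecidableEq Q]
    (φ : G →+ Q) (F A : Finset G) (hF : ∀ u ∈ F, ∀ v ∈ F, φ u = φ v) :
    F.card * (A.image φ).card ≤ (F + A).card := by
  have : ∀ q ∈ A.image φ, ∃ a ∈ A, φ a = q := by simp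
  choose! s hs hs' using this
  rw [← Finset.card_product]
  apply Finset.card_le_card_of_injOn (fun p => p.1 + s p.2)
  · rintro ⟨u, q⟩ h
    simp only [coe_product, Set.mem_prod, mem_coe] at h
    exact Finset.add_mem_add h.1 (hs _ h.2)
  · rintro ⟨u, q⟩ h ⟨u', q'⟩ h' e
    simp only [coe_product, Set.mem_prod, mem_coe] at h h' e
    have e2 := congrArg φ e
    rw [map_add, map_add, hF u h.1 u' h'.1, hs' _ h.2, hs' _ h'.2] at e2
    have : q = q' := add_left_cancel e2
    subst this
    simp at e
    simp [e]

theorem bm {G Q : Type*} [AddCommGroup G] [AddCommGroup Q] [DecidableEq G] [DecidableEq Q]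
    [IsAddTorsionFree G] [IsAddTorsionFree Q]
    (φ : G →+ Q) (X Y : Finset G) (hX : X.Nonempty) (hY : Y.Nonempty) :
    ∃ F ⊆ X + Y, (∀ u ∈ F, ∀ v ∈ F, φ u = φ v) ∧
      ((X.image φ).card + (Y.image φ).card) *
        ((Y.image φ).card * X.card + (X.image φ).card * Y.card) ≤
      (X.image φ).card * (Y.image φ).card *
        (F.card + (X + Y).card + ((X.image φ).card + (Y.image φ).card)) := by
  let fib : Finset G → Q → Finset G := fun A q => A.filter (fun a => φ a = q)
  have hsum : ∀ A : Finset G, ∑ q ∈ A.image φ, (fib A q).card = A.card := by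
    intro A
    exact (Finset.card_eq_sum_card_image φ A).symm
  obtain ⟨x, hx, hxs⟩ := conj_part (X.image φ) (fun q => (fib X q).card)
  obtain ⟨y, hy, hys⟩ := conj_part (Y.image φ) (fun q => (fib Y q).card)
  obtain ⟨z, hz, hzs⟩ := conj_part ((X+Y).image φ) (fun q => (fib (X+Y) q).card)
  simp only [hsum] at hxs hys hzs
  have hz0 : ∃ F ⊆ X + Y, (∀ u ∈ F, ∀ v ∈ F, φ u = φ v) ∧ z 0 ≤ F.card := by
    rcases Nat.eq_zero_or_pos (z 0) with h0 | h0
    · exact ⟨∅, by simp, by simp, by simp [h0]⟩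
    · have := (hz 0 (z 0) h0).1 le_rfl
      obtain ⟨q, hq⟩ := Finset.card_pos.1 this
      rw [mem_filter] at hq
      refine ⟨fib (X+Y) q, Finset.filter_subset _ _, ?_, hq.2⟩
      intro u hu v hv
      simp only [fib, mem_filter] at hu hv
      rw [hu.2, hv.2]
  obtain ⟨F, hF1, hF2, hF3⟩ := hz0
  refine ⟨F, hF1, hF2, ?_⟩
  have hX' : 0 < (X.image φ).card := Finset.card_pos.2 (hX.image φ)
  have hY' : 0 < (Y.image φ).card := Finset.card_pos.2 (hY.image φ)
  have hzanti : ∀ k l, k ≤ l → z l ≤ z k := by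
    intro k l hkl
    rcases Nat.eq_zero_or_pos (z l) with h0 | h0
    · omega
    · exact (hz k _ h0).2 (lt_of_le_of_lt hkl ((hz l _ h0).1 le_rfl))
  -- thresholds
  have thr : ∀ (A : Finset G) (x : ℕ → ℕ), 
      (∀ k v, 1 ≤ v → (v ≤ x k ↔ k < ((A.image φ).filter (fun q => v ≤ (fib A q).card)).card)) →
      ∀ i < (A.image φ).card, i < ((A.image φ).filter (fun q => x i ≤ (fib A q).card)).card := by
    intro A x hx i hi
    rcases Nat.eq_zero_or_pos (x i) with h0 | h0
    · simpa [h0] using hi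
    · exact (hx i _ h0).1 le_rfl
  have main := path_sum (X.image φ).card (Y.image φ).card (X+Y).card hX' hY' x y z hzanti ?_ ?_
  · rw [hxs _ le_rfl, hys _ le_rfl] at main
    refine main.trans ?_
    gcongr
  · intro i j hi hj
    have h1 := thr X x hx i hi
    have h2 := thr Y y hy j hj
    set P := (X.image φ).filter (fun q => x i ≤ (fib X q).card)
    set R := (Y.image φ).filter (fun q => y j ≤ (fib Y q).card)
    have hP : P.Nonempty := Finset.card_pos.1 (by omega)
    have hR : R.Nonempty := Finset.card_pos.1 (by omega)
    by_cases hv : x i + y j ≤ 1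
    · omega
    have : x i + y j - 1 ≤ z (i + j) := by
      rw [hz _ _ (by omega)]
      have cd := cauchy_davenport_of_isAddTorsionFree hP hR
      refine lt_of_lt_of_le (show i + j < P.card + R.card - 1 by omega) (cd.trans ?_)
      apply Finset.card_le_card
      intro s hs
      obtain ⟨p, hp, r, hr, rfl⟩ := Finset.mem_add.1 hs
      simp only [P, R, mem_filter, mem_image] at hp hr ⊢
      obtain ⟨⟨a, ha, rfl⟩, hp⟩ := hp
      obtain ⟨⟨b, hb, rfl⟩, hr⟩ := hr
      refine ⟨⟨a + b, Finset.add_mem_add ha hb, map_add _ _ _⟩, ?_⟩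
      have n1 : (fib X (φ a)).Nonempty := ⟨a, by simp [fib, ha]⟩
      have n2 : (fib Y (φ b)).Nonempty := ⟨b, by simp [fib, hb]⟩
      have cd2 := cauchy_davenport_of_isAddTorsionFree n1 n2
      have : fib X (φ a) + fib Y (φ b) ⊆ fib (X+Y) (φ a + φ b) := by
        intro w hw
        obtain ⟨u, hu, v, hv, rfl⟩ := Finset.mem_add.1 hw
        simp only [fib, mem_filter] at hu hv ⊢
        exact ⟨Finset.add_mem_add hu.1 hv.1, by rw [map_add, hu.2, hv.2]⟩
      have := Finset.card_le_card this
      omega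
    omega
  · rw [← hzs (max (X.image φ).card ((X+Y).image φ).card + (Y.image φ).card) (by omega)]
    apply Finset.sum_le_sum_of_subset
    intro k hk
    simp only [mem_range] at hk ⊢
    omega

/-- The dilate of a finite set of reals by the square root of two. -/
noncomputable def dil (A : Finset ℝ) : Finset ℝ := A.image (fun b => Real.sqrt 2 * b)

theorem mem_dil {A : Finset ℝ} {a : ℝ} (h : a ∈ A) : Real.sqrt 2 * a ∈ dil A :=
  Finset.mem_image_of_mem _ h

theorem card_dil (A : Finset ℝ) : (dil A).card = A.card := by
  apply Finset.card_image_of_injective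
  intro a b h
  have : Real.sqrt 2 ≠ 0 := by positivity
  exact mul_left_cancel₀ this h

theorem image2_eq (A : Finset ℝ) :
    Finset.image₂ (fun a b => a + Real.sqrt 2 * b) A A = A + dil A := by
  ext x
  simp only [mem_image₂, mem_add, dil, mem_image]
  constructor
  · rintro ⟨a, ha, b, hb, rfl⟩
    exact ⟨a, ha, _, ⟨b, hb, rfl⟩, rfl⟩
  · rintro ⟨a, ha, _, ⟨b, hb, rfl⟩, rfl⟩
    exact ⟨a, ha, b, hb, rfl⟩

theorem pluen (A B : Finset ℝ) (hA : A.Nonempty) (K : ℕ) (h : (A + B).card ≤ K * A.card) (m n : ℕ) :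
    (m • B - n • B).card ≤ K ^ (m + n) * A.card := by
  have h1 := Finset.pluennecke_ruzsa_inequality_nsmul_sub_nsmul_add hA B m n
  have hpos : (0 : ℚ≥0) < A.card := by exact_mod_cast hA.card_pos
  have h2 : ((A + B).card / A.card : ℚ≥0) ≤ K := by
    rw [div_le_iff₀ hpos]; exact_mod_cast h
  have h3 : ((m • B - n • B).card : ℚ≥0) ≤ (K : ℚ≥0) ^ (m + n) * A.card := by
    refine h1.trans ?_
    gcongr
  exact_mod_cast h3

theorem bbound (A : Finset ℝ) (hA : A.Nonempty) (h : (A + dil A).card ≤ 6 * A.card) (m n : ℕ) :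
    (m • (A ∪ dil A) - n • (A ∪ dil A)).card ≤ 42 ^ (m + n) * A.card := by
  apply pluen A _ hA
  have h1 : (A + A).card ≤ 36 * A.card := by
    have := pluen (dil A) A (by rw [← Finset.card_pos, card_dil, Finset.card_pos]; exact hA) 6
      (by rw [add_comm, card_dil]; exact h) 2 0
    rw [card_dil] at this
    simpa [two_nsmul] using this
  rw [Finset.add_union]
  refine (Finset.card_union_le _ _).trans ?_
  omega

theorem exists_ap (L : ℕ) : ∃ N : ℕ, ∀ A : Finset ℝ, N ≤ A.card →
    (∀ j : ℕ, (j • A + A).card ≤ 42 ^ (j + 1) * A.card) →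
    ∃ d : ℝ, d ≠ 0 ∧ ∀ j < L, (j : ℝ) * d ∈ (A - A) - (A - A) := by
  refine ⟨∏ j : Fin L, 42 ^ ((j : ℕ) + 1) + 1, fun A hA hK => ?_⟩
  have hne : A.Nonempty := Finset.card_pos.1 (by omega)
  have hcov : ∀ j : Fin L, ∃ F : Finset ℝ, F.card ≤ 42 ^ ((j : ℕ) + 1) ∧
      (j : ℕ) • A ⊆ F + (A - A) := by
    intro j
    obtain ⟨F, _, h1, h2⟩ := Finset.ruzsa_covering_add (K := (42 : ℝ) ^ ((j : ℕ) + 1)) hne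
      (A := (j : ℕ) • A) (by exact_mod_cast hK j)
    exact ⟨F, by exact_mod_cast h1, h2⟩
  choose F hF1 hF2 using hcov
  have hx : ∀ a ∈ A, ∀ j : Fin L, ∃ x ∈ F j, ((j : ℕ) : ℝ) * a - x ∈ A - A := by
    intro a ha j
    have : (j : ℕ) • a ∈ (j : ℕ) • A := Finset.nsmul_mem_nsmul ha
    obtain ⟨x, hx, u, hu, e⟩ := Finset.mem_add.1 (hF2 j this)
    refine ⟨x, hx, ?_⟩
    rw [nsmul_eq_mul] at e
    rw [← e]
    simpa using hu
  choose! x hx1 hx2 using hx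
  have hcard : (Fintype.piFinset F).card < A.card := by
    rw [Fintype.card_piFinset]
    have : ∏ j, (F j).card ≤ ∏ j : Fin L, 42 ^ ((j : ℕ) + 1) :=
      Finset.prod_le_prod' (fun j _ => hF1 j)
    omega
  obtain ⟨a, ha, b, hb, hab, e⟩ := Finset.exists_ne_map_eq_of_card_lt_of_maps_to hcard
    (f := x) (fun a ha => Fintype.mem_piFinset.2 (fun j => hx1 a ha j))
  refine ⟨a - b, sub_ne_zero.2 hab, fun j hj => ?_⟩
  have h1 := hx2 a ha ⟨j, hj⟩
  have h2 := hx2 b hb ⟨j, hj⟩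
  rw [e] at h1
  have := Finset.sub_mem_sub h1 h2
  convert this using 1
  push_cast
  ring

theorem line_indep (p q : ℚ) (h : (p : ℝ) = Real.sqrt 2 * q) : q = 0 := by
  by_contra hq
  have hq' : (q : ℝ) ≠ 0 := by exact_mod_cast hq
  apply irrational_sqrt_two
  refine ⟨p / q, ?_⟩
  push_cast
  field_simp
  linarith

/-- few cosets of a rational line is impossible -/
theorem many_lines (A : Finset ℝ) (hA : A.Nonempty) (h : (A + dil A).card ≤ 6 * A.card) (d : ℝ)
    (hd : d ≠ 0) (V : Submodule ℚ ℝ) (hV : V = Submodule.span ℚ {d}) [DecidableEq (ℝ ⧸ V)] :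
    A.card ≤ 6 * ((dil A).image V.mkQ).card ^ 2 := by
  set Im := (dil A).image V.mkQ with hIm
  have hmap : ∀ a ∈ A, V.mkQ (Real.sqrt 2 * a) ∈ Im := fun a ha =>
    Finset.mem_image_of_mem _ (mem_dil ha)
  have hImne : Im.Nonempty := by
    obtain ⟨a, ha⟩ := hA
    exact ⟨_, hmap a ha⟩
  obtain ⟨q, hq, hq2⟩ : ∃ q ∈ Im, A.card ≤ Im.card * (A.filter (fun a => V.mkQ (Real.sqrt 2 * a) = q)).card := by
    by_contra! hcon
    have h1 := Finset.card_eq_sum_card_fiberwise (f := fun a => V.mkQ (Real.sqrt 2 * a)) (s := A) (t := Im) hmap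
    have h2 : ∑ q ∈ Im, Im.card * (A.filter (fun a => V.mkQ (Real.sqrt 2 * a) = q)).card < ∑ q ∈ Im, A.card :=
      Finset.sum_lt_sum_of_nonempty hImne hcon
    rw [← Finset.mul_sum, ← h1] at h2
    simp at h2
  set A' := A.filter (fun a => V.mkQ (Real.sqrt 2 * a) = q) with hA'
  have hsub : A' ⊆ A := Finset.filter_subset _ _
  have hmul : A'.card * A'.card ≤ (A + dil A).card := by
    rw [← Finset.card_product]
    apply Finset.card_le_card_of_injOn (fun p => p.1 + Real.sqrt 2 * p.2)
    · rintro ⟨u, v⟩ huv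
      simp only [coe_product, Set.mem_prod, mem_coe] at huv
      exact Finset.add_mem_add (hsub huv.1) (mem_dil (hsub huv.2))
    · have hdiff : ∀ u ∈ A', ∀ v ∈ A', ∃ r : ℚ, (r : ℝ) * d = Real.sqrt 2 * u - Real.sqrt 2 * v := by
        intro u hu v hv
        simp only [hA', mem_filter] at hu hv
        have : V.mkQ (Real.sqrt 2 * u) = V.mkQ (Real.sqrt 2 * v) := by rw [hu.2, hv.2]
        rw [← sub_eq_zero, ← map_sub] at this
        simp only [Submodule.mkQ_apply, Submodule.Quotient.mk_eq_zero] at this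
        rw [hV, Submodule.mem_span_singleton] at this
        obtain ⟨r, hr⟩ := this
        exact ⟨r, by rw [← hr, Rat.smul_def]⟩
      rintro ⟨u, v⟩ huv ⟨u', v'⟩ huv' e
      simp only [coe_product, Set.mem_prod, mem_coe] at huv huv' e
      obtain ⟨r, hr⟩ := hdiff u huv.1 u' huv'.1
      obtain ⟨s, hs⟩ := hdiff v' huv'.2 v huv.2
      have h0 : (0:ℝ) < Real.sqrt 2 := by positivity
      have : (r : ℝ) * d = Real.sqrt 2 * s * d := by
        rw [mul_assoc, hs, hr, ← mul_sub]
        congr 1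
        linarith
      have h3 := mul_right_cancel₀ hd this
      have h4 := line_indep r s h3
      rw [h4] at hs
      have h5 : v' = v := by
        have : Real.sqrt 2 * (v' - v) = 0 := by rw [mul_sub, ← hs]; simp
        rcases mul_eq_zero.1 this with h | h
        · exact absurd h h0.ne'
        · linarith
      subst h5
      have : u = u' := by linarith
      rw [this]
  have hapos := hA.card_pos
  have : A.card * A.card ≤ A.card * (6 * Im.card ^ 2) := by
    calc A.card * A.card ≤ (Im.card * A'.card) * (Im.card * A'.card) := Nat.mul_le_mul hq2 hq2
      _ = Im.card ^ 2 * (A'.card * A'.card) := by ring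
      _ ≤ Im.card ^ 2 * (6 * A.card) := Nat.mul_le_mul_left _ (hmul.trans h)
      _ = _ := by ring
  exact Nat.le_of_mul_le_mul_left this hapos

theorem sqrt_two_facts : (0:ℝ) < Real.sqrt 2 ∧ Real.sqrt 2 * Real.sqrt 2 = 2 ∧ Real.sqrt 2 < 3/2 := by
  have h2 : Real.sqrt 2 * Real.sqrt 2 = 2 := Real.mul_self_sqrt (by norm_num)
  have h1 : (0:ℝ) < Real.sqrt 2 := by positivity
  exact ⟨h1, h2, by nlinarith⟩

theorem arith_key (m n x a F s e ε : ℝ) (hm : 0 < m) (hn : 0 < n) (hx : 0 ≤ x) (ha : 2 * x ≤ a)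
    (h : (m + n) * (n * x + m * a) ≤ m * n * (F + s + (m + n)))
    (hmF : m ≤ e * a) (hnF : n ≤ e * a) (hF : F ≤ e * a) (he : 0 ≤ e) (hae : a ≤ 6 * x)
    (heps : 18 * e ≤ ε) : ((1 + Real.sqrt 2) ^ 2 - ε) * x ≤ s := by
  obtain ⟨h1, h2, h3⟩ := sqrt_two_facts
  have hmn : 0 < m * n := by positivity
  have k1 : 2 * Real.sqrt 2 * (m * n) * x ≤ n * n * x + m * m * a := by
    have : 0 ≤ (n - Real.sqrt 2 * m) ^ 2 * x := by positivity
    have e1 : (n - Real.sqrt 2 * m) ^ 2 * x = n * n * x - 2 * Real.sqrt 2 * (m * n) * x + (Real.sqrt 2 * Real.sqrt 2) * (m * m) * x := by ring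
    rw [e1, h2] at this
    have : m * m * (2 * x) ≤ m * m * a := by gcongr
    linarith
  have k2 : m * n * (3 * x + 2 * Real.sqrt 2 * x) ≤ m * n * (F + s + (m + n)) := by
    refine le_trans ?_ h
    have : m * n * (2 * x) ≤ m * n * a := by gcongr
    nlinarith
  have k3 := le_of_mul_le_mul_left k2 hmn
  have k4 : e * a ≤ e * (6 * x) := by gcongr
  have k5 : 18 * e * x ≤ ε * x := by gcongr
  have k6 : (1 + Real.sqrt 2) ^ 2 = 3 + 2 * Real.sqrt 2 := by
    have : (1 + Real.sqrt 2) ^ 2 = 1 + 2 * Real.sqrt 2 + Real.sqrt 2 * Real.sqrt 2 := by ring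
    rw [this, h2]; ring
  rw [k6]
  nlinarith

theorem key (ε : ℝ) (hε : 0 < ε) : ∃ N : ℕ, ∀ A : Finset ℝ, N ≤ A.card →
    (A + dil A).card ≤ 6 * A.card → ∀ X ⊆ A, 2 * X.card ≤ A.card →
    ((1 + Real.sqrt 2) ^ 2 - ε) * X.card ≤ (X + dil A).card := by
  classical
  obtain ⟨L, hL⟩ := exists_nat_gt (18 * 42 ^ 5 / ε)
  have hLpos : (0:ℝ) < L := lt_trans (by positivity) hL
  have hLpos' : 0 < L := by exact_mod_cast hLpos
  obtain ⟨N, hN⟩ := exists_ap L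
  refine ⟨N + 6 * L ^ 2 + 1, fun A hA hK X hXA hX => ?_⟩
  obtain ⟨s1, s2, s3⟩ := sqrt_two_facts
  have hAne : A.Nonempty := Finset.card_pos.1 (by omega)
  have hTne : (dil A).Nonempty := by rw [← Finset.card_pos, card_dil]; omega
  rcases X.eq_empty_or_nonempty with rfl | hXne
  · simp
  have hTle : A.card ≤ (X + dil A).card := by
    have := Finset.card_le_card_add_left (t := dil A) hXne
    rwa [card_dil] at this
  by_cases h6 : 6 * X.card ≤ A.card
  · have : (6 * X.card : ℝ) ≤ (X + dil A).card := by exact_mod_cast h6.trans hTle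
    refine le_trans ?_ this
    gcongr
    nlinarith
  have hBB := bbound A hAne hK
  set B := A ∪ dil A with hB
  have hAB : A ⊆ B := Finset.subset_union_left
  have hTB : dil A ⊆ B := Finset.subset_union_right
  obtain ⟨d, hd, hdj⟩ := hN A (by omega) (by
    intro j
    refine le_trans (Finset.card_le_card ?_) (hBB (j+1) 0)
    simp only [zero_nsmul, sub_zero]
    rw [succ_nsmul]
    exact Finset.add_subset_add (Finset.nsmul_subset_nsmul_left hAB) hAB)
  obtain ⟨V, hV⟩ : ∃ V : Submodule ℚ ℝ, V = Submodule.span ℚ {d} := ⟨_, rfl⟩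
  have hml := many_lines A hAne hK d hd V hV
  have : IsAddTorsionFree (ℝ ⧸ V) := .of_module_rat _
  let φ : ℝ →+ ℝ ⧸ V := V.mkQ.toAddMonoidHom
  let F : Finset ℝ := (range L).image (fun j : ℕ => (j : ℝ) * d)
  have hFcard : F.card = L := by
    rw [Finset.card_image_of_injective, card_range]
    intro i j hij
    exact_mod_cast mul_right_cancel₀ hd hij
  have hFφ : ∀ u ∈ F, ∀ v ∈ F, φ u = φ v := by
    have : ∀ u ∈ F, φ u = 0 := by
      intro u hu
      obtain ⟨j, _, rfl⟩ := Finset.mem_image.1 hu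
      change V.mkQ _ = 0
      simp only [Submodule.mkQ_apply, Submodule.Quotient.mk_eq_zero]
      rw [hV, Submodule.mem_span_singleton]
      exact ⟨j, by rw [Rat.smul_def]; simp⟩
    intro u hu v hv
    rw [this u hu, this v hv]
  have hF2 : ∀ Y ⊆ B, F + Y ⊆ 3 • B - 2 • B := by
    intro Y hY w hw
    obtain ⟨u, hu, y, hy, rfl⟩ := Finset.mem_add.1 hw
    obtain ⟨j, hj, rfl⟩ := Finset.mem_image.1 hu
    have := hdj j (mem_range.1 hj)
    obtain ⟨p, hp, q, hq, e⟩ := Finset.mem_sub.1 this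
    obtain ⟨a, ha, b, hb, rfl⟩ := Finset.mem_sub.1 hp
    obtain ⟨a', ha', b', hb', rfl⟩ := Finset.mem_sub.1 hq
    have e2 : (j : ℝ) * d + y = (a + b' + y) - (b + a') := by rw [← e]; ring
    simp only [e2]
    apply Finset.sub_mem_sub
    · rw [succ_nsmul, two_nsmul]
      exact Finset.add_mem_add (Finset.add_mem_add (hAB ha) (hAB hb')) (hY hy)
    · rw [two_nsmul]
      exact Finset.add_mem_add (hAB hb) (hAB ha')
  have hm := fibre_mul φ F X hFφ
  have hn := fibre_mul φ F (dil A) hFφ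
  rw [hFcard] at hm hn
  replace hm := (hm.trans (Finset.card_le_card (hF2 X (hXA.trans hAB)))).trans (hBB 3 2)
  replace hn := (hn.trans (Finset.card_le_card (hF2 _ hTB))).trans (hBB 3 2)
  obtain ⟨F', hF1', hF2', hbm⟩ := bm φ X (dil A) hXne hTne
  have hz := fibre_mul φ F' (dil A) hF2'
  replace hz := (hz.trans (Finset.card_le_card (t := 3 • B - 0 • B) (by
    simp only [zero_nsmul, sub_zero]
    rw [succ_nsmul, two_nsmul]
    refine Finset.add_subset_add (hF1'.trans ?_) hTB
    exact Finset.add_subset_add (hXA.trans hAB) hTB))).trans (hBB 3 0)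
  have hml' : A.card ≤ 6 * ((dil A).image φ).card ^ 2 := hml
  rw [card_dil] at hbm
  have hm0 : 0 < (X.image φ).card := Finset.card_pos.2 (hXne.image φ)
  have hn0 : 0 < ((dil A).image φ).card := Finset.card_pos.2 (hTne.image φ)
  generalize (X.image φ).card = m at *
  generalize ((dil A).image φ).card = n at *
  have hLn : L ≤ n := by
    by_contra hcon
    have : n ^ 2 < L ^ 2 := Nat.pow_lt_pow_left (by omega) (by norm_num)
    omega
  have hz' : L * F'.card ≤ 42 ^ (3 + 2) * A.card := by
    calc L * F'.card ≤ n * F'.card := Nat.mul_le_mul_right _ hLn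
      _ = F'.card * n := by ring
      _ ≤ _ := hz
      _ ≤ _ := Nat.mul_le_mul_right _ (by norm_num)
  have conv : ∀ k : ℕ, L * k ≤ 42 ^ (3 + 2) * A.card → (k : ℝ) ≤ (42 ^ 5 / L) * A.card := by
    intro k hk
    rw [div_mul_eq_mul_div, le_div_iff₀ hLpos]
    have : (L : ℝ) * k ≤ 42 ^ (3+2) * A.card := by exact_mod_cast hk
    rw [mul_comm]
    exact this
  apply arith_key m n X.card A.card F'.card _ (42 ^ 5 / L) ε
  · exact_mod_cast hm0
  · exact_mod_cast hn0
  · positivity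
  · exact_mod_cast hX
  · exact_mod_cast hbm
  · exact conv _ hm
  · exact conv _ hn
  · exact conv _ hz'
  · positivity
  · have : A.card ≤ 6 * X.card := by omega
    exact_mod_cast this
  · rw [div_lt_iff₀ hε] at hL
    rw [← mul_div_assoc, div_le_iff₀ hLpos]
    linarith

theorem exists_split (A : Finset ℝ) (hA : 2 ≤ A.card) : ∃ H : AddSubgroup ℝ,
    (∀ a ∈ A, ∀ b ∈ A, Real.sqrt 2 * (a - b) ∈ H) ∧ ∃ a ∈ A, ∃ b ∈ A, a - b ∉ H := by
  classical
  obtain ⟨s1, s2, s3⟩ := sqrt_two_facts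
  let D : Finset ℝ := (A - A) ∪ dil (A - A)
  let M : Submodule ℤ ℝ := Submodule.span ℤ (D : Set ℝ)
  let T : ℝ →ₗ[ℤ] ℝ := (AddMonoidHom.mulLeft (Real.sqrt 2)).toIntLinearMap
  have hT : ∀ x, T x = Real.sqrt 2 * x := fun x => rfl
  have hmem : ∀ a ∈ A, ∀ b ∈ A, a - b ∈ M := fun a ha b hb =>
    Submodule.subset_span (by
      simp only [D, Finset.coe_union, Set.mem_union, Finset.mem_coe]
      exact Or.inl (Finset.sub_mem_sub ha hb))
  refine ⟨(M.map T).toAddSubgroup, ?_, ?_⟩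
  · intro a ha b hb
    exact ⟨a - b, hmem a ha b hb, rfl⟩
  · by_contra! hcon
    have hle : M ≤ (Ideal.span {(2 : ℤ)}) • M := by
      have hTM : M ≤ M.map T := by
        apply Submodule.span_le.2
        intro x hx
        simp only [D, Finset.coe_union, Set.mem_union, Finset.mem_coe, dil, mem_image] at hx
        rcases hx with hx | ⟨y, hy, rfl⟩
        · obtain ⟨a, ha, b, hb, rfl⟩ := Finset.mem_sub.1 hx
          exact hcon a ha b hb
        · obtain ⟨a, ha, b, hb, rfl⟩ := Finset.mem_sub.1 hy
          exact ⟨a - b, hmem a ha b hb, rfl⟩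
      intro x hx
      obtain ⟨y, hy, rfl⟩ := hTM hx
      obtain ⟨w, hw, rfl⟩ := hTM hy
      have : T (T w) = (2 : ℤ) • w := by
        rw [hT, hT, ← mul_assoc, s2]; simp
      rw [this]
      exact Submodule.smul_mem_smul (Ideal.mem_span_singleton_self _) hw
    have hfg : M.FG := ⟨D, rfl⟩
    obtain ⟨r, hr1, hr2⟩ := Submodule.exists_sub_one_mem_and_smul_eq_zero_of_fg_of_le_smul _ M hfg hle
    obtain ⟨a, ha, b, hb, hab⟩ := Finset.one_lt_card.1 hA
    have := hr2 _ (hmem a ha b hb)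
    rw [Ideal.mem_span_singleton] at hr1
    have hr0 : r ≠ 0 := by rintro rfl; omega
    rw [smul_eq_zero] at this
    rcases this with h | h
    · exact hr0 h
    · exact hab (sub_eq_zero.1 h)

theorem lower_aux (ε : ℝ) (hε : 0 < ε) (N : ℕ) (hN2 : 2 ≤ N)
    (hN : ∀ A : Finset ℝ, N ≤ A.card →
    (A + dil A).card ≤ 6 * A.card → ∀ X ⊆ A, 2 * X.card ≤ A.card →
    ((1 + Real.sqrt 2) ^ 2 - ε) * X.card ≤ (X + dil A).card) (k : ℕ) :
    ∀ A : Finset ℝ, A.card = k →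
      ((1 + Real.sqrt 2) ^ 2 - ε) * A.card - 6 * N ≤ (A + dil A).card := by
  classical
  obtain ⟨s1, s2, s3⟩ := sqrt_two_facts
  have hf6 : (1 + Real.sqrt 2) ^ 2 - ε ≤ 6 := by nlinarith
  induction k using Nat.strong_induction_on with
  | _ k ih =>
  intro A hAk
  have htriv : ((1 + Real.sqrt 2) ^ 2 - ε) * A.card ≤ 6 * A.card := by gcongr
  by_cases h1 : A.card < N
  · have : (A.card : ℝ) ≤ N := by exact_mod_cast h1.le
    have : (0:ℝ) ≤ (A + dil A).card := by positivity
    linarith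
  by_cases h2 : 6 * A.card < (A + dil A).card
  · have : (6 * A.card : ℝ) ≤ (A + dil A).card := by exact_mod_cast h2.le
    have : (0:ℝ) ≤ N := by positivity
    linarith
  push Not at h1 h2
  obtain ⟨H, hH1, a, ha, b, hb, hab⟩ := exists_split A (hN2.trans h1)
  let π : ℝ →+ ℝ ⧸ H := QuotientAddGroup.mk' H
  have hπ : ∀ x, π x = 0 ↔ x ∈ H := fun x => QuotientAddGroup.eq_zero_iff x
  let fib : ℝ ⧸ H → Finset ℝ := fun q => A.filter (fun a => π a = q)
  have hsub : ∀ q, fib q ⊆ A := fun q => Finset.filter_subset _ _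
  obtain ⟨q0, hq0, hmax⟩ := Finset.exists_max_image (A.image π) (fun q => (fib q).card)
    ⟨π a, Finset.mem_image_of_mem _ ha⟩
  have hdisj : ∀ q q', q ≠ q' → Disjoint (fib q) (fib q') := by
    intro q q' hqq
    rw [Finset.disjoint_left]
    intro x hx hx'
    simp only [fib, mem_filter] at hx hx'
    exact hqq (hx.2.symm.trans hx'.2)
  have hsum : A.card = ∑ q ∈ A.image π, (fib q).card := Finset.card_eq_sum_card_image π A
  have hsmall : ∀ q ∈ A.image π, q ≠ q0 → 2 * (fib q).card ≤ A.card := by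
    intro q hq hne
    have h3 : (fib q ∪ fib q0).card ≤ A.card :=
      Finset.card_le_card (Finset.union_subset (hsub _) (hsub _))
    rw [Finset.card_union_of_disjoint (hdisj _ _ hne)] at h3
    have := hmax q hq
    omega
  have hlt : (fib q0).card < A.card := by
    apply Finset.card_lt_card
    refine ⟨hsub _, fun hall => hab ?_⟩
    have h3 := hall ha
    have h4 := hall hb
    simp only [fib, mem_filter] at h3 h4
    rw [← hπ, map_sub, h3.2, h4.2, sub_self]
  have hbig : ∑ q ∈ A.image π, (fib q + dil A).card ≤ (A + dil A).card := by
    rw [← Finset.card_biUnion]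
    · apply Finset.card_le_card
      intro x hx
      obtain ⟨q, hq, hx⟩ := Finset.mem_biUnion.1 hx
      exact Finset.add_subset_add_right (hsub q) hx
    · intro q hq q' hq' hne
      rw [Function.onFun, Finset.disjoint_left]
      intro x hx hx'
      obtain ⟨u, hu, v, hv, rfl⟩ := Finset.mem_add.1 hx
      obtain ⟨u', hu', v', hv', e⟩ := Finset.mem_add.1 hx'
      simp only [fib, mem_filter] at hu hu'
      obtain ⟨c, hc, rfl⟩ := Finset.mem_image.1 hv
      obtain ⟨c', hc', rfl⟩ := Finset.mem_image.1 hv'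
      apply hne
      rw [← hu.2, ← hu'.2, ← sub_eq_zero, ← map_sub, hπ]
      have : u - u' = Real.sqrt 2 * (c' - c) := by linarith
      rw [this]
      exact hH1 _ hc' _ hc
  have hbig' : ∑ q ∈ A.image π, ((fib q + dil A).card : ℝ) ≤ (A + dil A).card := by
    exact_mod_cast hbig
  have hsum' : (A.card : ℝ) = ∑ q ∈ A.image π, ((fib q).card : ℝ) := by exact_mod_cast hsum
  rw [← Finset.add_sum_erase _ _ hq0] at hbig' hsum'
  have hrest : ((1 + Real.sqrt 2) ^ 2 - ε) * ∑ q ∈ (A.image π).erase q0, ((fib q).card : ℝ) ≤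
      ∑ q ∈ (A.image π).erase q0, ((fib q + dil A).card : ℝ) := by
    rw [Finset.mul_sum]
    apply Finset.sum_le_sum
    intro q hq
    rw [Finset.mem_erase] at hq
    exact hN A h1 h2 _ (hsub q) (hsmall q hq.2 hq.1)
  have hfirst := ih (fib q0).card (hAk ▸ hlt) (fib q0) rfl
  have hmono : ((fib q0 + dil (fib q0)).card : ℝ) ≤ (fib q0 + dil A).card := by
    exact_mod_cast Finset.card_le_card (Finset.add_subset_add_left (Finset.image_subset_image (hsub q0)))
  have e2 : ((1 + Real.sqrt 2) ^ 2 - ε) * (A.card : ℝ) = ((1 + Real.sqrt 2) ^ 2 - ε) * (fib q0).card +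
     ((1 + Real.sqrt 2) ^ 2 - ε) * ∑ q ∈ (A.image π).erase q0, ((fib q).card : ℝ) := by
    rw [hsum']; ring
  linarith

theorem lower (ε : ℝ) (hε : 0 < ε) : ∃ N : ℕ, ∀ A : Finset ℝ, N ≤ A.card →
    ((1 + Real.sqrt 2) ^ 2 - ε) * A.card ≤ (A + dil A).card := by
  obtain ⟨N, hN⟩ := key (ε / 2) (by positivity)
  have haux := lower_aux (ε / 2) (by positivity) (N + 2) (by omega)
    (fun A hA => hN A (by omega))
  obtain ⟨R, hR⟩ := exists_nat_gt (6 * ((N + 2 : ℕ) : ℝ) / (ε / 2))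
  refine ⟨R, fun A hA => ?_⟩
  have h1 := haux A.card A rfl
  rw [div_lt_iff₀ (by positivity)] at hR
  have : (R : ℝ) * (ε / 2) ≤ A.card * (ε / 2) := by gcongr
  linarith

theorem upper_box (n p r : ℕ) (h : n ≤ p * r) : ∃ A : Finset ℝ, A.card = n ∧
    (A + dil A).card ≤ (p + 2 * r) * (p + r) := by
  let g : ℕ × ℕ → ℝ := fun x => x.1 + Real.sqrt 2 * x.2
  have hg : Function.Injective g := by
    rintro ⟨a, b⟩ ⟨c, d⟩ e
    simp only [g] at e
    have h1 := line_indep ((a : ℚ) - c) ((d : ℚ) - b) (by push_cast; linarith)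
    have h2 : (d : ℚ) = b := by linarith
    have h3 : d = b := by exact_mod_cast h2
    subst h3
    have : (a : ℝ) = c := by linarith
    have : a = c := by exact_mod_cast this
    rw [this]
  obtain ⟨S, hS, hSn⟩ := Finset.exists_subset_card_eq (s := range p ×ˢ range r) (n := n) (by simpa using h)
  refine ⟨S.image g, by rw [Finset.card_image_of_injective _ hg, hSn], ?_⟩
  have : S.image g + dil (S.image g) ⊆ (range (p + 2 * r) ×ˢ range (p + r)).image g := by
    intro x hx
    obtain ⟨u, hu, v, hv, rfl⟩ := Finset.mem_add.1 hx
    obtain ⟨w, hw, rfl⟩ := Finset.mem_image.1 hv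
    obtain ⟨⟨a, b⟩, h1, rfl⟩ := Finset.mem_image.1 hu
    obtain ⟨⟨c, d⟩, h2, rfl⟩ := Finset.mem_image.1 hw
    have h1 := hS h1
    have h2 := hS h2
    simp only [mem_product, mem_range] at h1 h2
    refine Finset.mem_image.2 ⟨(a + 2 * d, b + c), ?_, ?_⟩
    · simp only [mem_product, mem_range]; omega
    · simp only [g]
      push_cast
      have := sqrt_two_facts.2.1
      linear_combination (-(d : ℝ)) * this
  refine (Finset.card_le_card this).trans (Finset.card_image_le.trans ?_)
  simp

theorem upper (ε : ℝ) (hε : 0 < ε) : ∃ N : ℕ, ∀ n, N ≤ n → ∃ A : Finset ℝ, A.card = n ∧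
    ((A + dil A).card : ℝ) ≤ ((1 + Real.sqrt 2) ^ 2 + ε) * n := by
  obtain ⟨s1, s2, s3⟩ := sqrt_two_facts
  obtain ⟨R, hR⟩ := exists_nat_gt (26 / ε)
  refine ⟨R ^ 2 + 1, fun n hn => ?_⟩
  set t := Real.sqrt (n / Real.sqrt 2) with ht
  have ht2 : t * t = n / Real.sqrt 2 := Real.mul_self_sqrt (by positivity)
  have ht3 : Real.sqrt 2 * (t * t) = n := by rw [ht2]; field_simp
  have ht0 : 0 ≤ t := Real.sqrt_nonneg _
  obtain ⟨A, hA1, hA2⟩ := upper_box n ⌈Real.sqrt 2 * t⌉₊ ⌈t⌉₊ (by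
    have h1 := Nat.le_ceil (Real.sqrt 2 * t)
    have h2 := Nat.le_ceil t
    have : (n : ℝ) ≤ (⌈Real.sqrt 2 * t⌉₊ : ℝ) * (⌈t⌉₊ : ℝ) := by
      calc (n : ℝ) = (Real.sqrt 2 * t) * t := by rw [← ht3]; ring
        _ ≤ _ := by gcongr
    exact_mod_cast this)
  refine ⟨A, hA1, ?_⟩
  have h1 := (Nat.ceil_lt_add_one (show 0 ≤ Real.sqrt 2 * t by positivity)).le
  have h2 := (Nat.ceil_lt_add_one ht0).le
  have h3 : ((A + dil A).card : ℝ) ≤ ((⌈Real.sqrt 2 * t⌉₊ : ℝ) + 2 * (⌈t⌉₊ : ℝ)) * ((⌈Real.sqrt 2 * t⌉₊ : ℝ) + (⌈t⌉₊ : ℝ)) := by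
    exact_mod_cast hA2
  have h4 : ((A + dil A).card : ℝ) ≤ ((Real.sqrt 2 * t + 1) + 2 * (t + 1)) * ((Real.sqrt 2 * t + 1) + (t + 1)) := by
    refine h3.trans ?_
    gcongr
  have hw : Real.sqrt n * Real.sqrt n = n := Real.mul_self_sqrt (by positivity)
  set w := Real.sqrt n
  have hw0 : 0 ≤ w := Real.sqrt_nonneg _
  have hRw : (R : ℝ) ≤ w := by
    apply Real.le_sqrt_of_sq_le
    exact_mod_cast (by omega : R ^ 2 ≤ n)
  have hw1 : 1 ≤ w := by
    apply Real.le_sqrt_of_sq_le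
    exact_mod_cast (by omega : 1 ^ 2 ≤ n)
  have htw : t ≤ w := by
    apply abs_le_of_sq_le_sq' _ hw0 |>.2
    have : 1 ≤ Real.sqrt 2 := by nlinarith
    nlinarith [mul_nonneg ht0 ht0]
  have hwe : 26 * w ≤ ε * n := by
    rw [div_lt_iff₀ hε] at hR
    have : 26 ≤ w * ε := by nlinarith
    rw [← hw]
    nlinarith
  refine h4.trans ?_
  have e1 : ((Real.sqrt 2 * t + 1) + 2 * (t + 1)) * ((Real.sqrt 2 * t + 1) + (t + 1)) =
     (1 + Real.sqrt 2) ^ 2 * (Real.sqrt 2 * (t * t)) + (7 + 5 * Real.sqrt 2) * t + 6 := by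
    linear_combination (-(Real.sqrt 2) * (t * t) - t*t) * s2
  rw [e1, ht3]
  have : (7 + 5 * Real.sqrt 2) * t ≤ 15 * t := by gcongr; linarith
  nlinarith

theorem stmt_9 :
    (∀ ε : ℝ, 0 < ε →
      ∃ N : ℕ,
        (∀ A : Finset ℝ, N ≤ A.card →
          ((Finset.image₂ (fun a b => a + Real.sqrt 2 * b) A A).card : ℝ) ≥
            ((1 + Real.sqrt 2) ^ 2 - ε) * (A.card : ℝ)) ∧
        (∃ A : Finset ℝ, N ≤ A.card ∧
          ((Finset.image₂ (fun a b => a + Real.sqrt 2 * b) A A).card : ℝ) ≤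
            ((1 + Real.sqrt 2) ^ 2 + ε) * (A.card : ℝ))) ∧
    Filter.Tendsto
      (fun n : ℕ =>
        sInf {r : ℝ | ∃ A : Finset ℝ, A.card = n ∧
          r = ((Finset.image₂ (fun a b => a + Real.sqrt 2 * b) A A).card : ℝ) / (A.card : ℝ)})
      Filter.atTop (nhds ((1 + Real.sqrt 2) ^ 2)) := by
  simp only [image2_eq]
  constructor
  · intro ε hε
    obtain ⟨N1, h1⟩ := lower ε hε
    obtain ⟨N2, h2⟩ := upper ε hε
    refine ⟨N1, fun A hA => h1 A hA, ?_⟩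
    obtain ⟨A, hA1, hA2⟩ := h2 (N1 + N2) (by omega)
    exact ⟨A, by omega, by rw [hA1]; exact hA2⟩
  · rw [Metric.tendsto_atTop]
    intro ε hε
    obtain ⟨N1, h1⟩ := lower (ε / 2) (by positivity)
    obtain ⟨N2, h2⟩ := upper (ε / 2) (by positivity)
    refine ⟨N1 + N2 + 1, fun n hn => ?_⟩
    have hn0 : (0 : ℝ) < n := by exact_mod_cast (by omega : 0 < n)
    obtain ⟨A, hA1, hA2⟩ := h2 n (by omega)
    set S := {r : ℝ | ∃ A : Finset ℝ, A.card = n ∧ r = ((A + dil A).card : ℝ) / (A.card : ℝ)} with hS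
    have hmem : ((A + dil A).card : ℝ) / (A.card : ℝ) ∈ S := ⟨A, hA1, rfl⟩
    have hlow : ∀ r ∈ S, (1 + Real.sqrt 2) ^ 2 - ε / 2 ≤ r := by
      rintro r ⟨B, hB, rfl⟩
      have := h1 B (by omega)
      rw [hB] at this ⊢
      rwa [le_div_iff₀ hn0]
    have k1 : (1 + Real.sqrt 2) ^ 2 - ε / 2 ≤ sInf S := le_csInf ⟨_, hmem⟩ hlow
    have k2 : sInf S ≤ (1 + Real.sqrt 2) ^ 2 + ε / 2 := by
      refine (csInf_le ⟨_, hlow⟩ hmem).trans ?_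
      rw [hA1, div_le_iff₀ hn0]
      exact hA2
    rw [Real.dist_eq, abs_lt]
    constructor <;> linarith
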